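/- arXiv:1709.06168 — 2 statements merged into one kernel-verified Lean document; each statement's English description precedes it below -/
import Mathlib

section
/- Let n₁,…,n_ℓ be natural numbers. If ℓ is odd then B(n₁,…,n_ℓ) = 0. If ℓ is even, then the series Σ 1/(k₁⋯k_ℓ), taken over all ℓ-tuples of nonzero integers (k₁,…,k_ℓ) with k₁/n₁ + ⋯ + k_ℓ/n_ℓ = 0, converges absolutely, and B(n₁,…,n_ℓ) = (i/(2π))^ℓ times this sum. In particular, for ℓ = 2 one has B(n₁,n₂) = gcd(n₁,n₂)²/(12 n₁ n₂). -/
open scoped Classical Real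
open Complex MeasureTheory

/-- The sawtooth function `ψ`. -/
noncomputable def saw (x : ℝ) : ℝ := if Int.fract x = 0 then 0 else Int.fract x - 1/2

/-- The correlation `B(n₁, …, n_ℓ)` of sawtooth functions. -/
noncomputable def Bcorr {l : ℕ} (n : Fin l → ℕ) : ℝ :=
  (1 / ∏ j, (n j : ℝ)) * ∫ x in (0 : ℝ)..(∏ j, (n j : ℝ)), ∏ j, saw (x / n j)

open Filter Topology

/-- The product of absolutely convergent series over a finite family of indices. -/
theorem hasSum_pi_prod_of_summable_norm {ι R : Type*} [NormedCommRing R] [NormOneClass R]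
    [CompleteSpace R] :
    ∀ {l : ℕ} (f : Fin l → ι → R), (∀ j, Summable fun i => ‖f j i‖) →
      (Summable fun k : Fin l → ι => ‖∏ j, f j (k j)‖) ∧
        HasSum (fun k : Fin l → ι => ∏ j, f j (k j)) (∏ j, ∑' i, f j i)
  | 0, f, _ => by
    refine ⟨Summable.of_finite, ?_⟩
    simp
  | l + 1, f, hf => by
    obtain ⟨h1, h2⟩ := hasSum_pi_prod_of_summable_norm (fun j => f j.succ) fun j => hf j.succ
    have h3 := summable_mul_of_summable_norm (hf 0) h1
    have h4 := (hf 0).mul_norm h1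
    have h5 := (hf 0).of_norm.hasSum.mul h2 h3
    rw [← (Fin.consEquiv fun _ : Fin (l + 1) => ι).summable_iff,
      ← (Fin.consEquiv fun _ : Fin (l + 1) => ι).hasSum_iff]
    refine ⟨?_, ?_⟩
    · refine h4.congr fun p => ?_
      simp [Fin.consEquiv, Fin.prod_univ_succ]
    · rw [Fin.prod_univ_succ]
      convert! h5 using 1
      ext p
      simp [Fin.consEquiv, Fin.prod_univ_succ]

theorem saw_neg (x : ℝ) : saw (-x) = -saw x := by
  unfold saw
  by_cases h : Int.fract x = 0
  · simp [h, Int.fract_neg_eq_zero]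
  · rw [if_neg h, if_neg (by rwa [Int.fract_neg_eq_zero]), Int.fract_neg h]
    ring

theorem saw_add_intCast (x : ℝ) (m : ℤ) : saw (x + m) = saw x := by
  simp [saw]

/-- The coefficients of the Abel means of the Fourier series of the sawtooth function. -/
noncomputable def abelCoeff (r : ℝ) (k : ℤ) : ℂ := (r : ℂ) ^ k.natAbs / k

theorem hasSum_abelCoeff_mul_exp {r : ℝ} (hr0 : 0 ≤ r) (hr1 : r < 1) (x : ℝ) :
    HasSum (fun k : ℤ => abelCoeff r k * cexp (2 * π * I * k * x))
      (-2 * I * arg (1 - r * cexp (2 * π * I * x))) := by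
  set z : ℂ := r * cexp (2 * π * I * x) with hz
  have hexp : ‖cexp (2 * π * I * x)‖ = 1 := by
    rw [show 2 * (π : ℂ) * I * x = ((2 * π * x : ℝ) : ℂ) * I by push_cast; ring]
    exact Complex.norm_exp_ofReal_mul_I _
  have hzn : ‖z‖ < 1 := by
    rw [hz, norm_mul, hexp, mul_one, Complex.norm_real, Real.norm_of_nonneg hr0]
    exact hr1
  have hconj : (starRingEnd ℂ) z = r * cexp (-(2 * π * I * x)) := by
    rw [hz, map_mul, Complex.conj_ofReal, ← Complex.exp_conj]
    simp only [map_mul, conj_ofReal, conj_I, map_ofNat]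
    ring_nf
  have hzc : ‖(starRingEnd ℂ) z‖ < 1 := by simpa using hzn
  have hre : 0 < (1 - z).re := by
    have := (Complex.abs_re_le_norm z).trans_lt hzn
    rw [abs_lt] at this
    simp only [sub_re, one_re]
    linarith [this.2]
  have hlog : log (1 - (starRingEnd ℂ) z) = (starRingEnd ℂ) (log (1 - z)) := by
    rw [← Complex.log_conj]
    · simp
    · intro h
      rw [Complex.arg_eq_pi_iff] at h
      linarith [h.1]
  have h1 := Complex.hasSum_taylorSeries_neg_log hzn
  have h2 := (Complex.hasSum_taylorSeries_neg_log hzc).neg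
  have key := HasSum.of_nat_of_neg (f := fun k : ℤ => abelCoeff r k * cexp (2 * π * I * k * x))
    (g := -log (1 - z)) (g' := - -log (1 - (starRingEnd ℂ) z)) ?_ ?_
  · convert! key using 1
    rw [hlog]
    apply Complex.ext <;> simp [abelCoeff, Complex.log_re, Complex.log_im]
    ring
  · convert! h1 using 1
    ext n
    simp only [abelCoeff, hz, Int.natAbs_natCast, Int.cast_natCast, mul_pow, ← Complex.exp_nat_mul]
    rw [show 2 * (π : ℂ) * I * n * x = n * (2 * π * I * x) by ring]
    ring
  · convert! h2 using 1
    ext n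
    simp only [abelCoeff, hconj, Int.natAbs_neg, Int.natAbs_natCast, Int.cast_neg,
      Int.cast_natCast, mul_pow, ← Complex.exp_nat_mul]
    rw [show 2 * (π : ℂ) * I * -n * x = n * -(2 * π * I * x) by ring, div_neg]
    ring

theorem norm_abelCoeff_le {r : ℝ} (hr0 : 0 ≤ r) (hr1 : r ≤ 1) (k : ℤ) :
    ‖abelCoeff r k‖ ≤ ‖(k : ℝ)⁻¹‖ := by
  rw [abelCoeff, norm_div, norm_pow, norm_inv, Complex.norm_real, Real.norm_of_nonneg hr0,
    Complex.norm_intCast, Real.norm_eq_abs, div_eq_mul_inv]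
  exact mul_le_of_le_one_left (by positivity) (pow_le_one₀ hr0 hr1)

theorem summable_norm_abelCoeff {r : ℝ} (hr0 : 0 ≤ r) (hr1 : r < 1) :
    Summable fun k : ℤ => ‖abelCoeff r k‖ := by
  have h := (hasSum_abelCoeff_mul_exp hr0 hr1 0).summable
  simpa using h.norm

theorem tendsto_abelCoeff (k : ℤ) :
    Tendsto (fun r : ℝ => abelCoeff r k) (𝓝[<] 1) (𝓝 (k : ℂ)⁻¹) := by
  have : Continuous fun r : ℝ => abelCoeff r k := by
    unfold abelCoeff; fun_prop
  have h := this.tendsto 1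
  simp only [abelCoeff, ofReal_one, one_pow, one_div] at h
  exact h.mono_left nhdsWithin_le_nhds

theorem tendsto_arg_one_sub_mul_exp {x : ℝ} (hx : Int.fract x ≠ 0) :
    Tendsto (fun r : ℝ => arg (1 - r * cexp (2 * π * I * x))) (𝓝[<] 1) (𝓝 (π * saw x)) := by
  set f := Int.fract x with hf
  have hf0 : 0 < f := lt_of_le_of_ne (Int.fract_nonneg x) (Ne.symm hx)
  have hf1 : f < 1 := Int.fract_lt_one x
  have hs : 0 < Real.sin (π * f) :=
    Real.sin_pos_of_pos_of_lt_pi (by positivity) (by nlinarith [Real.pi_pos])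
  have he : cexp (2 * π * I * x) = cexp (2 * π * I * f) := by
    rw [← Int.floor_add_fract x, ← hf]
    push_cast
    rw [mul_add, Complex.exp_add, show 2 * (π : ℂ) * I * (⌊x⌋ : ℂ) = ⌊x⌋ * (2 * π * I) by ring,
      Complex.exp_int_mul_two_pi_mul_I, one_mul]
  have hpolar : 1 - cexp (2 * π * I * f) = ((2 * Real.sin (π * f) : ℝ) : ℂ) *
      (cos ((π * (f - 1 / 2) : ℝ) : ℂ) + sin ((π * (f - 1 / 2) : ℝ) : ℂ) * I) := by
    rw [show 2 * (π : ℂ) * I * f = ((2 * (π * f) : ℝ) : ℂ) * I by push_cast; ring,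
      Complex.exp_mul_I, ← ofReal_cos, ← ofReal_sin, ← ofReal_cos, ← ofReal_sin,
      Real.cos_two_mul, Real.sin_two_mul, show π * (f - 1 / 2) = π * f - π / 2 by ring,
      Real.cos_sub_pi_div_two, Real.sin_sub_pi_div_two]
    have := Real.sin_sq_add_cos_sq (π * f)
    apply Complex.ext <;> simp [-ofReal_cos, -ofReal_sin, -ofReal_mul]
    linarith
  have harg : arg (1 - cexp (2 * π * I * x)) = π * saw x := by
    rw [he, hpolar, Complex.arg_mul_cos_add_sin_mul_I (by positivity)]
    · simp [saw, ← hf, hx]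
    · constructor <;> nlinarith [Real.pi_pos]
  have hslit : 1 - ((1 : ℝ) : ℂ) * cexp (2 * π * I * x) ∈ slitPlane := by
    rw [ofReal_one, one_mul, he, hpolar]
    left
    rw [← ofReal_cos, ← ofReal_sin, show π * (f - 1 / 2) = π * f - π / 2 by ring,
      Real.cos_sub_pi_div_two, Real.sin_sub_pi_div_two]
    simp [-ofReal_cos, -ofReal_sin, -ofReal_mul]
    positivity
  have hc : ContinuousAt (fun r : ℝ => arg (1 - r * cexp (2 * π * I * x))) 1 :=
    (Complex.continuousAt_arg hslit).comp (f := fun r : ℝ => 1 - (r : ℂ) * cexp (2 * π * I * x))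
      (by fun_prop)
  have h := hc.tendsto
  simp only [ofReal_one, one_mul, harg] at h
  exact h.mono_left nhdsWithin_le_nhds

theorem integral_exp_two_pi_mul {s N : ℝ} {m : ℤ} (h : s * N = m) :
    ∫ x in (0 : ℝ)..N, cexp (2 * π * I * s * x) = if s = 0 then (N : ℂ) else 0 := by
  split_ifs with hs
  · simp [hs]
  · have hc : 2 * (π : ℂ) * I * s ≠ 0 :=
      mul_ne_zero Complex.two_pi_I_ne_zero (by exact_mod_cast hs)
    rw [integral_exp_mul_complex hc,
      show 2 * (π : ℂ) * I * s * N = m * (2 * π * I) by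
        rw [show 2 * (π : ℂ) * I * s * N = ((s * N : ℝ) : ℂ) * (2 * π * I) by push_cast; ring, h]
        simp,
      Complex.exp_int_mul_two_pi_mul_I]
    simp

theorem hasSum_integral_prod_abel {l : ℕ} (n : Fin l → ℕ) (hn : ∀ j, 0 < n j) {r : ℝ}
    (hr0 : 0 ≤ r) (hr1 : r < 1) :
    HasSum (fun k : Fin l → ℤ =>
        if ∑ j, (k j : ℝ) / n j = 0 then
          ((∏ j, (n j : ℝ) : ℝ) : ℂ) * ∏ j, abelCoeff r (k j) else 0)
      (∫ x in (0 : ℝ)..(∏ j, (n j : ℝ)),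
        ∏ j, (-2 * I * arg (1 - r * cexp (2 * π * I * (x / n j : ℝ))))) := by
  set N : ℝ := ∏ j, (n j : ℝ) with hN
  have hprod (x : ℝ) := hasSum_pi_prod_of_summable_norm
    (fun j (k : ℤ) => abelCoeff r k * cexp (2 * π * I * k * (x / n j : ℝ)))
    fun j => (hasSum_abelCoeff_mul_exp hr0 hr1 (x / n j)).summable.norm
  have hbound := (hasSum_pi_prod_of_summable_norm (fun (_ : Fin l) (k : ℤ) => abelCoeff r k)
    fun j => summable_norm_abelCoeff hr0 hr1).1
  have hF (k : Fin l → ℤ) (x : ℝ) :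
      ∏ j, (abelCoeff r (k j) * cexp (2 * π * I * k j * (x / n j : ℝ))) =
        (∏ j, abelCoeff r (k j)) * cexp (2 * π * I * (∑ j, (k j : ℝ) / n j : ℝ) * x) := by
    rw [Finset.prod_mul_distrib, ← Complex.exp_sum]
    congr 2
    push_cast
    rw [Finset.mul_sum, Finset.sum_mul]
    exact Finset.sum_congr rfl fun j _ => by ring
  have hint (k : Fin l → ℤ) : ∃ m : ℤ, (∑ j, (k j : ℝ) / n j) * N = m := by
    refine ⟨∑ j, k j * ∏ i ∈ Finset.univ.erase j, (n i : ℤ), ?_⟩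
    push_cast
    rw [Finset.sum_mul]
    refine Finset.sum_congr rfl fun j _ => ?_
    rw [hN, ← Finset.mul_prod_erase Finset.univ _ (Finset.mem_univ j)]
    have : (n j : ℝ) ≠ 0 := by exact_mod_cast (hn j).ne'
    field_simp
  have key := intervalIntegral.hasSum_integral_of_dominated_convergence (μ := volume) (a := 0)
    (b := N)
    (F := fun (k : Fin l → ℤ) (x : ℝ) =>
      ∏ j, (abelCoeff r (k j) * cexp (2 * π * I * k j * (x / n j : ℝ))))
    (f := fun x => ∏ j, (-2 * I * arg (1 - r * cexp (2 * π * I * (x / n j : ℝ)))))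
    (fun k _ => ‖∏ j, abelCoeff r (k j)‖) ?_ ?_ ?_ ?_ ?_
  · convert! key using 1
    ext k
    obtain ⟨m, hm⟩ := hint k
    simp_rw [hF]
    rw [intervalIntegral.integral_const_mul, integral_exp_two_pi_mul hm]
    split_ifs <;> ring
  · intro k
    exact Continuous.aestronglyMeasurable (by fun_prop)
  · refine fun k => ae_of_all _ fun x _ => ?_
    rw [hF, norm_mul, show 2 * (π : ℂ) * I * (∑ j, (k j : ℝ) / n j : ℝ) * x =
      ((2 * π * (∑ j, (k j : ℝ) / n j) * x : ℝ) : ℂ) * I by push_cast; ring,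
      Complex.norm_exp_ofReal_mul_I, mul_one]
  · exact ae_of_all _ fun x _ => hbound
  · exact intervalIntegrable_const
  · refine ae_of_all _ fun x _ => ?_
    convert! (hprod x).2 using 1
    exact Finset.prod_congr rfl fun j _ => (hasSum_abelCoeff_mul_exp hr0 hr1 (x / n j)).tsum_eq.symm

theorem ae_forall_fract_div_ne_zero {l : ℕ} (n : Fin l → ℕ) (hn : ∀ j, 0 < n j) :
    ∀ᵐ x : ℝ, ∀ j, Int.fract (x / n j) ≠ 0 := by
  rw [ae_all_iff]
  intro j
  have hc : (Set.range fun m : ℤ => (m : ℝ) * n j).Countable := Set.countable_range _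
  filter_upwards [hc.ae_notMem volume] with x hx h
  refine hx ⟨⌊x / n j⌋, ?_⟩
  have : (n j : ℝ) ≠ 0 := by exact_mod_cast (hn j).ne'
  have h' := Int.floor_add_fract (x / n j)
  rw [h, add_zero] at h'
  simp only [h']
  field_simp

theorem tendsto_integral_prod_abel {l : ℕ} (n : Fin l → ℕ) (hn : ∀ j, 0 < n j) (N : ℝ) :
    Tendsto (fun r : ℝ => ∫ x in (0 : ℝ)..N,
        ∏ j, (-2 * I * arg (1 - r * cexp (2 * π * I * (x / n j : ℝ))))) (𝓝[<] 1)
      (𝓝 (∫ x in (0 : ℝ)..N, ∏ j, (-2 * I * (π * saw (x / n j) : ℝ)))) := by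
  refine intervalIntegral.tendsto_integral_filter_of_dominated_convergence
    (fun _ => ∏ _j : Fin l, 2 * π) ?_ ?_ ?_ ?_
  · refine Eventually.of_forall fun r => Measurable.aestronglyMeasurable ?_
    refine Finset.measurable_prod _ fun j _ => ?_
    refine Measurable.const_mul (Complex.measurable_ofReal.comp (Complex.measurable_arg.comp ?_)) _
    exact Continuous.measurable (by fun_prop)
  · refine Eventually.of_forall fun r => ae_of_all _ fun x _ => ?_
    rw [norm_prod]
    refine Finset.prod_le_prod (fun _ _ => norm_nonneg _) fun j _ => ?_
    simpa using Complex.abs_arg_le_pi _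
  · exact intervalIntegrable_const
  · filter_upwards [ae_forall_fract_div_ne_zero n hn] with x hx _
    refine tendsto_finsetProd _ fun j _ => Tendsto.const_mul _ ?_
    exact (Complex.continuous_ofReal.tendsto _).comp (tendsto_arg_one_sub_mul_exp (hx j))

/-- The Fourier expansion of `Bcorr`, given absolute convergence. -/
theorem Bcorr_eq_tsum_ite {l : ℕ} (n : Fin l → ℕ) (hn : ∀ j, 0 < n j)
    (hS : Summable fun k : Fin l → ℤ =>
      if ∑ j, (k j : ℝ) / n j = 0 then ∏ j, ‖(k j : ℝ)⁻¹‖ else 0) :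
    (Bcorr n : ℂ) = (I / (2 * π)) ^ l * ∑' k : Fin l → ℤ,
      if ∑ j, (k j : ℝ) / n j = 0 then ∏ j, (k j : ℂ)⁻¹ else 0 := by
  have hN : (∏ j, (n j : ℝ)) ≠ 0 :=
    Finset.prod_ne_zero_iff.2 fun j _ => by exact_mod_cast (hn j).ne'
  have hmem : ∀ᶠ r : ℝ in 𝓝[<] 1, 0 ≤ r ∧ r < 1 := by
    filter_upwards [Ioo_mem_nhdsLT (show (0 : ℝ) < 1 by norm_num)] with r hr
    exact ⟨hr.1.le, hr.2⟩
  have h1 : Tendsto (fun r : ℝ => ∑' k : Fin l → ℤ, if ∑ j, (k j : ℝ) / n j = 0 then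
      ((∏ j, (n j : ℝ) : ℝ) : ℂ) * ∏ j, abelCoeff r (k j) else 0) (𝓝[<] 1)
      (𝓝 (∑' k : Fin l → ℤ, if ∑ j, (k j : ℝ) / n j = 0 then
        ((∏ j, (n j : ℝ) : ℝ) : ℂ) * ∏ j, (k j : ℂ)⁻¹ else 0)) := by
    refine tendsto_tsum_of_dominated_convergence (hS.mul_left ‖((∏ j, (n j : ℝ) : ℝ) : ℂ)‖) ?_ ?_
    · intro k
      split_ifs
      · exact (tendsto_finsetProd _ fun j _ => tendsto_abelCoeff (k j)).const_mul _
      · exact tendsto_const_nhds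
    · filter_upwards [hmem] with r hr k
      split_ifs
      · rw [norm_mul, norm_prod]
        gcongr with j
        exact norm_abelCoeff_le hr.1 hr.2.le _
      · simp
  have h2 := tendsto_integral_prod_abel n hn (∏ j, (n j : ℝ))
  have h3 := tendsto_nhds_unique (h1.congr' (by
    filter_upwards [hmem] with r hr
    exact (hasSum_integral_prod_abel n hn hr.1 hr.2).tsum_eq)) h2
  have h4 (x : ℝ) : ∏ j, (-2 * I * (π * saw (x / n j) : ℝ)) =
      (-2 * I * π) ^ l * ((∏ j, saw (x / n j) : ℝ) : ℂ) := by
    push_cast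
    simp_rw [← mul_assoc]
    rw [Finset.prod_mul_distrib]
    simp
  have h5 (k : Fin l → ℤ) : (if ∑ j, (k j : ℝ) / n j = 0 then
        ((∏ j, (n j : ℝ) : ℝ) : ℂ) * ∏ j, (k j : ℂ)⁻¹ else 0) =
      ((∏ j, (n j : ℝ) : ℝ) : ℂ) * if ∑ j, (k j : ℝ) / n j = 0 then ∏ j, (k j : ℂ)⁻¹ else 0 := by
    split_ifs <;> simp
  simp_rw [h4, h5] at h3
  rw [tsum_mul_left, intervalIntegral.integral_const_mul, intervalIntegral.integral_ofReal] at h3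
  have h6 : (I / (2 * π)) ^ l * (-2 * I * π) ^ l = 1 := by
    rw [← mul_pow]
    have : (π : ℂ) ≠ 0 := by exact_mod_cast Real.pi_ne_zero
    rw [show I / (2 * π) * (-2 * I * π) = -(I * I) by field_simp, Complex.I_mul_I]
    simp
  have hNc : ((∏ j, (n j : ℝ) : ℝ) : ℂ) ≠ 0 := by exact_mod_cast hN
  rw [Bcorr, ofReal_mul, ofReal_div, ofReal_one, one_div, inv_mul_eq_iff_eq_mul₀ hNc,
    mul_left_comm, h3, ← mul_assoc, h6, one_mul]

theorem prod_norm_inv_le_sum {m : ℕ} (x : Fin (m + 2) → ℝ) (hx : ∀ j, x j ≠ 0) :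
    ∏ j, ‖(x j)⁻¹‖ ≤
      ∑ i : Fin (m + 2), ∏ j, |x (i.succAbove j)| ^ (-((m + 2 : ℝ) / (m + 1))) := by
  set y : Fin (m + 2) → ℝ := fun j => |x j| ^ (-((m + 2 : ℝ) / (m + 1))) with hy
  have hy0 (j) : 0 < y j := Real.rpow_pos_of_pos (abs_pos.2 (hx j)) _
  set a : Fin (m + 2) → ℝ := fun i => ∏ j, y (i.succAbove j) with ha
  have ha0 (i) : 0 < a i := Finset.prod_pos fun j _ => hy0 _
  have hm2 : (m + 2 : ℝ) ≠ 0 := by positivity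
  have hm1 : (m + 1 : ℝ) ≠ 0 := by positivity
  have hP : 0 < ∏ j, y j := Finset.prod_pos fun j _ => hy0 _
  have hprod : ∏ i, a i = (∏ j, y j) ^ (m + 1) := by
    have h1 (i) : y i * a i = ∏ j, y j := (Fin.prod_univ_succAbove y i).symm
    have h2 : (∏ i, y i) * ∏ i, a i = (∏ j, y j) ^ (m + 2) := by
      rw [← Finset.prod_mul_distrib, Finset.prod_congr rfl fun i _ => h1 i]
      simp
    refine mul_left_cancel₀ hP.ne' ?_
    rw [h2]
    ring
  have hgm := Real.geom_mean_le_arith_mean_weighted Finset.univ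
    (fun _ : Fin (m + 2) => (m + 2 : ℝ)⁻¹) a (fun _ _ => by positivity)
    (by simp; field_simp) fun i _ => (ha0 i).le
  rw [Real.finsetProd_rpow _ _ fun i _ => (ha0 i).le, hprod, ← Real.rpow_natCast,
    ← Real.rpow_mul hP.le, ← Real.finsetProd_rpow _ _ fun i _ => (hy0 i).le] at hgm
  calc ∏ j, ‖(x j)⁻¹‖ = ∏ j, y j ^ (((m + 1 : ℕ) : ℝ) * (m + 2 : ℝ)⁻¹) := by
        refine Finset.prod_congr rfl fun j _ => ?_
        rw [hy, ← Real.rpow_mul (abs_nonneg _), norm_inv, Real.norm_eq_abs, ← Real.rpow_neg_one]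
        congr 1
        push_cast
        field_simp
    _ ≤ ∑ i, (m + 2 : ℝ)⁻¹ * a i := hgm
    _ ≤ ∑ i, a i := by
        refine Finset.sum_le_sum fun i _ => mul_le_of_le_one_left (ha0 i).le ?_
        exact inv_le_one_of_one_le₀ (by linarith [(Nat.cast_nonneg m : (0 : ℝ) ≤ m)])

theorem summable_prod_norm_inv {l : ℕ} (n : Fin l → ℕ) (hn : ∀ j, 0 < n j) (hl : l ≠ 1) :
    Summable fun k : {k : Fin l → ℤ // (∀ j, k j ≠ 0) ∧ ∑ j, (k j : ℝ) / n j = 0} =>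
      ∏ j, ‖(k.1 j : ℝ)⁻¹‖ := by
  match l, hl with
  | 0, _ => exact Summable.of_finite
  | m + 2, _ =>
    have hsum : Summable fun k : Fin (m + 1) → ℤ =>
        ∏ j, |(k j : ℝ)| ^ (-((m + 2 : ℝ) / (m + 1))) := by
      have hp : 1 < (m + 2 : ℝ) / (m + 1) := by
        rw [one_lt_div (by positivity)]
        linarith
      exact (hasSum_pi_prod_of_summable_norm
        (fun (_ : Fin (m + 1)) (k : ℤ) => |(k : ℝ)| ^ (-((m + 2 : ℝ) / (m + 1))))
        fun _ => (Real.summable_abs_int_rpow hp).norm).1.of_norm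
    refine Summable.of_nonneg_of_le (fun k => Finset.prod_nonneg fun _ _ => norm_nonneg _)
      (fun k => prod_norm_inv_le_sum (fun j => (k.1 j : ℝ)) fun j => by
        exact_mod_cast k.2.1 j) ?_
    refine summable_sum fun i _ => ?_
    refine hsum.comp_injective (i := fun k : {k : Fin (m + 2) → ℤ //
      (∀ j, k j ≠ 0) ∧ ∑ j, (k j : ℝ) / n j = 0} => fun j => k.1 (i.succAbove j)) ?_
    intro k k' h
    have h' (j) : k.1 (i.succAbove j) = k'.1 (i.succAbove j) := congrFun h j
    have hk := k.2.2
    have hk' := k'.2.2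
    rw [Fin.sum_univ_succAbove _ i] at hk hk'
    simp_rw [h'] at hk
    have hni : (n i : ℝ) ≠ 0 := by exact_mod_cast (hn i).ne'
    have hi : (k.1 i : ℝ) / n i = k'.1 i / n i := by linarith
    rw [div_left_inj' hni] at hi
    ext j
    rcases Fin.eq_self_or_eq_succAbove i j with rfl | ⟨j, rfl⟩
    · exact_mod_cast hi
    · exact h' j

theorem summable_ite_prod_norm_inv {l : ℕ} (n : Fin l → ℕ) (hn : ∀ j, 0 < n j) (hl : l ≠ 1) :
    Summable fun k : Fin l → ℤ =>
      if ∑ j, (k j : ℝ) / n j = 0 then ∏ j, ‖(k j : ℝ)⁻¹‖ else 0 := by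
  rw [← (Subtype.val_injective (p := fun k : Fin l → ℤ =>
    (∀ j, k j ≠ 0) ∧ ∑ j, (k j : ℝ) / n j = 0)).summable_iff]
  · refine (summable_prod_norm_inv n hn hl).congr fun k => ?_
    simp only [Function.comp_apply]
    rw [if_pos k.2.2]
  · intro k hk
    split_ifs with h0
    · by_contra h
      refine hk ⟨⟨k, fun j hj => h ?_, h0⟩, rfl⟩
      exact Finset.prod_eq_zero (Finset.mem_univ j) (by simp [hj])
    · rfl

theorem tsum_ite_prod_inv {l : ℕ} (n : Fin l → ℕ) :
    ∑' k : {k : Fin l → ℤ // (∀ j, k j ≠ 0) ∧ ∑ j, (k j : ℝ) / n j = 0},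
        (∏ j, (k.1 j : ℂ))⁻¹ =
      ∑' k : Fin l → ℤ, if ∑ j, (k j : ℝ) / n j = 0 then ∏ j, (k j : ℂ)⁻¹ else 0 := by
  rw [← (Subtype.val_injective (p := fun k : Fin l → ℤ =>
    (∀ j, k j ≠ 0) ∧ ∑ j, (k j : ℝ) / n j = 0)).tsum_eq]
  · refine tsum_congr fun k => ?_
    rw [if_pos k.2.2, Finset.prod_inv_distrib]
  · intro k hk
    rw [Function.mem_support] at hk
    have h0 : ∑ j, (k j : ℝ) / n j = 0 := by
      by_contra h
      exact hk (if_neg h)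
    rw [if_pos h0, Finset.prod_ne_zero_iff] at hk
    exact ⟨⟨k, fun j hj => hk j (Finset.mem_univ j) (by simp [hj]), h0⟩, rfl⟩

theorem Bcorr_eq_zero_of_odd {l : ℕ} (n : Fin l → ℕ) (hn : ∀ j, 0 < n j) (hl : Odd l) :
    Bcorr n = 0 := by
  have hrefl (x : ℝ) (j : Fin l) : saw (((∏ j, (n j : ℝ)) - x) / n j) = -saw (x / n j) := by
    have h : ((∏ j, (n j : ℝ)) - x) / n j =
        -(x / n j) + ((∏ i ∈ Finset.univ.erase j, (n i : ℤ) : ℤ) : ℝ) := by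
      rw [← Finset.mul_prod_erase Finset.univ _ (Finset.mem_univ j)]
      have : (n j : ℝ) ≠ 0 := by exact_mod_cast (hn j).ne'
      push_cast
      field_simp
      ring
    rw [h, saw_add_intCast, saw_neg]
  have h := intervalIntegral.integral_comp_sub_left (a := 0) (b := ∏ j, (n j : ℝ))
    (fun x => ∏ j, saw (x / n j)) (∏ j, (n j : ℝ))
  simp_rw [hrefl, Finset.prod_neg] at h
  simp only [Finset.card_univ, Fintype.card_fin, hl.neg_one_pow, neg_mul, one_mul,
    intervalIntegral.integral_neg, sub_self, sub_zero] at h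
  rw [Bcorr, show ∫ x in (0 : ℝ)..(∏ j, (n j : ℝ)), ∏ j, saw (x / n j) = 0 by linarith, mul_zero]

theorem hasSum_int_inv_sq : HasSum (fun t : ℤ => ((t : ℂ) ^ 2)⁻¹) (π ^ 2 / 3) := by
  have h : HasSum (fun n : ℕ => ((n : ℂ) ^ 2)⁻¹) (π ^ 2 / 6) := by
    have := (Complex.hasSum_ofReal.2 hasSum_zeta_two)
    simpa using this
  have key := HasSum.of_nat_of_neg (f := fun t : ℤ => ((t : ℂ) ^ 2)⁻¹) (by simpa using h)
    (by simpa using h)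
  convert! key using 1
  simp
  ring

theorem Bcorr_pair {n₁ n₂ : ℕ} (h₁ : 0 < n₁) (h₂ : 0 < n₂) :
    Bcorr ![n₁, n₂] = (Nat.gcd n₁ n₂ : ℝ) ^ 2 / (12 * n₁ * n₂) := by
  have hn : ∀ j, 0 < ![n₁, n₂] j := by
    intro j
    fin_cases j <;> simpa
  have key := Bcorr_eq_tsum_ite _ hn (summable_ite_prod_norm_inv _ hn (by norm_num))
  obtain ⟨g, a, b, hg, hab, rfl, rfl⟩ := Nat.exists_coprime' (Nat.gcd_pos_of_pos_left n₂ h₁)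
  have ha : 0 < a := Nat.pos_of_mul_pos_right h₁
  have hb : 0 < b := Nat.pos_of_mul_pos_right h₂
  have hgcd : Nat.gcd (a * g) (b * g) = g := by
    rw [Nat.gcd_mul_right, hab.gcd_eq_one, one_mul]
  have haR : (a : ℝ) ≠ 0 := by exact_mod_cast ha.ne'
  have hbR : (b : ℝ) ≠ 0 := by exact_mod_cast hb.ne'
  have hgR : (g : ℝ) ≠ 0 := by exact_mod_cast hg.ne'
  have hcond (k : Fin 2 → ℤ) : ∑ j, (k j : ℝ) / ((![a * g, b * g] j : ℕ) : ℝ) = 0 ↔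
      k 0 * b = -(k 1 * a) := by
    simp only [Fin.sum_univ_two, Matrix.cons_val_zero, Matrix.cons_val_one, Nat.cast_mul]
    have h3 : (k 0 : ℝ) / (a * g) + k 1 / (b * g) = (k 0 * b + k 1 * a) / (a * b * g) := by
      field_simp
    rw [h3, div_eq_zero_iff, or_iff_left (by positivity), add_eq_zero_iff_eq_neg]
    exact_mod_cast Iff.rfl
  have hinj : Function.Injective fun t : ℤ => (![a * t, -(b * t)] : Fin 2 → ℤ) := by
    intro t t' h
    have h0 := congrFun h 0
    simpa [ha.ne'] using h0
  simp_rw [hcond] at key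
  rw [← hinj.tsum_eq] at key
  · have hterm (t : ℤ) : (if (![a * t, -(b * t)] : Fin 2 → ℤ) 0 * b =
        -((![a * t, -(b * t)] : Fin 2 → ℤ) 1 * a) then
        ∏ j, (((![a * t, -(b * t)] : Fin 2 → ℤ) j : ℤ) : ℂ)⁻¹ else 0) =
        -((a : ℂ) * b)⁻¹ * ((t : ℂ) ^ 2)⁻¹ := by
      rw [if_pos (by simp; ring)]
      simp [Fin.prod_univ_two]
      ring
    simp_rw [hterm] at key
    rw [tsum_mul_left, hasSum_int_inv_sq.tsum_eq] at key
    rw [hgcd, ← Complex.ofReal_inj, key, div_pow, Complex.I_sq]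
    have haC : (a : ℂ) ≠ 0 := by exact_mod_cast ha.ne'
    have hbC : (b : ℂ) ≠ 0 := by exact_mod_cast hb.ne'
    have hgC : (g : ℂ) ≠ 0 := by exact_mod_cast hg.ne'
    have hpi : (π : ℂ) ≠ 0 := by exact_mod_cast Real.pi_ne_zero
    push_cast
    field_simp
    norm_num
  · intro k hk
    rw [Function.mem_support] at hk
    have h0 : k 0 * b = -(k 1 * a) := by
      by_contra h
      exact hk (if_neg h)
    have hdvd : (a : ℤ) ∣ k 0 := by
      refine (Nat.isCoprime_iff_coprime.2 hab).dvd_of_dvd_mul_right ⟨-k 1, ?_⟩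
      rw [h0]
      ring
    obtain ⟨t, ht⟩ := hdvd
    refine ⟨t, ?_⟩
    have haZ : (a : ℤ) ≠ 0 := by exact_mod_cast ha.ne'
    have h1 : k 1 = -(b * t) := by
      refine mul_left_cancel₀ haZ ?_
      rw [ht] at h0
      linarith
    ext j
    fin_cases j <;> simp [ht, h1]

/-- Proposition 3.1, part 1: vanishing for odd `ℓ`, the absolutely convergent Fourier
series expression for even `ℓ`, and the case `ℓ = 2`. -/
theorem Bcorr_fourier_expansion {l : ℕ} (n : Fin l → ℕ) (hn : ∀ j, 0 < n j) :
    (Odd l → Bcorr n = 0) ∧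
    (Even l →
      Summable (fun k : {k : Fin l → ℤ // (∀ j, k j ≠ 0) ∧ ∑ j, (k j : ℝ) / n j = 0} =>
        (∏ j, (k.1 j : ℝ))⁻¹) ∧
      (Bcorr n : ℂ) = (Complex.I / (2 * Real.pi)) ^ l *
        ∑' k : {k : Fin l → ℤ // (∀ j, k j ≠ 0) ∧ ∑ j, (k j : ℝ) / n j = 0},
          (∏ j, (k.1 j : ℂ))⁻¹) ∧
    (∀ n₁ n₂ : ℕ, 0 < n₁ → 0 < n₂ →
      Bcorr ![n₁, n₂] = (Nat.gcd n₁ n₂ : ℝ) ^ 2 / (12 * n₁ * n₂)) := by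
  refine ⟨Bcorr_eq_zero_of_odd n hn, fun hl => ?_, fun n₁ n₂ h₁ h₂ => Bcorr_pair h₁ h₂⟩
  have hl1 : l ≠ 1 := by
    rintro rfl
    exact absurd hl (by decide)
  refine ⟨(summable_prod_norm_inv n hn hl1).of_norm_bounded fun k => ?_, ?_⟩
  · rw [norm_inv, norm_prod, ← Finset.prod_inv_distrib]
    simp
  · rw [tsum_ite_prod_inv]
    exact Bcorr_eq_tsum_ite n hn (summable_ite_prod_norm_inv n hn hl1)
end

section
/- There is an absolute constant A such that for all real y ≥ 2 and all real N with 1 ≤ N ≤ y, one has Σ_{N < n₁ ≤ 2N} Σ_{N < n₂ ≤ 2N} |(1/y) ∫₀^y ψ(x/n₁) ψ(x/n₂) dx| ≤ A (log y)² (N + N² √N/√y), where the sums run over integers n₁, n₂. -/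
open scoped Classical Real
open Complex MeasureTheory

/-- The `1`-periodic extension of the second Bernoulli polynomial from `[0, 1)`. -/
noncomputable def bernTwo (x : ℝ) : ℝ := Int.fract x ^ 2 - Int.fract x + 1 / 6

/-- The `1`-periodic extension of the third Bernoulli polynomial from `[0, 1)`. -/
noncomputable def bernThree (x : ℝ) : ℝ :=
  Int.fract x ^ 3 - 3 / 2 * Int.fract x ^ 2 + 1 / 2 * Int.fract x

lemma abs_saw_le (x : ℝ) : |saw x| ≤ 1 / 2 := by
  unfold saw
  have h0 := Int.fract_nonneg x
  have h1 := Int.fract_lt_one x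
  split_ifs
  · norm_num
  · rw [abs_le]; constructor <;> linarith

lemma measurable_saw : Measurable saw :=
  Measurable.ite (measurableSet_eq_fun measurable_fract measurable_const) measurable_const
    (measurable_fract.sub_const _)

lemma abs_bernTwo_le (x : ℝ) : |bernTwo x| ≤ 1 / 6 := by
  unfold bernTwo
  have h0 := Int.fract_nonneg x
  have h1 := Int.fract_lt_one x
  rw [abs_le]; constructor <;> nlinarith [sq_nonneg (Int.fract x - 1 / 2)]

lemma abs_bernThree_le (x : ℝ) : |bernThree x| ≤ 1 / 8 := by
  unfold bernThree
  set t := Int.fract x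
  have h0 : 0 ≤ t := Int.fract_nonneg x
  have h1 : t < 1 := Int.fract_lt_one x
  have h2 : 0 ≤ t * (1 - t) := mul_nonneg h0 (by linarith)
  have h3 : t * (1 - t) ≤ 1 / 4 := by nlinarith [sq_nonneg (t - 1 / 2)]
  have e : t ^ 3 - 3 / 2 * t ^ 2 + 1 / 2 * t = t * (1 - t) * (1 / 2 - t) := by ring
  rw [e, abs_mul, abs_of_nonneg h2]
  have : |1 / 2 - t| ≤ 1 / 2 := by rw [abs_le]; constructor <;> linarith
  nlinarith [abs_nonneg (1 / 2 - t)]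

lemma continuous_bernTwo : Continuous bernTwo :=
  ContinuousOn.comp_fract'' (f := fun t : ℝ => t ^ 2 - t + 1 / 6)
    (by fun_prop) (by norm_num)

lemma continuous_bernThree : Continuous bernThree :=
  ContinuousOn.comp_fract'' (f := fun t : ℝ => t ^ 3 - 3 / 2 * t ^ 2 + 1 / 2 * t)
    (by fun_prop) (by norm_num)

lemma hasDerivAt_fract {x : ℝ} (hx : Int.fract x ≠ 0) :
    HasDerivAt (Int.fract : ℝ → ℝ) 1 x := by
  have h0 : 0 < Int.fract x := lt_of_le_of_ne (Int.fract_nonneg x) (Ne.symm hx)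
  have h : (Int.fract : ℝ → ℝ) =ᶠ[nhds x] fun t => t - ⌊x⌋ := by
    have h1 : (⌊x⌋ : ℝ) < x := by rw [Int.fract] at h0; linarith
    filter_upwards [Ioo_mem_nhds h1 (Int.lt_floor_add_one x)] with t ht
    have : ⌊t⌋ = ⌊x⌋ := Int.floor_eq_iff.2 ⟨ht.1.le, ht.2⟩
    rw [Int.fract, this]
  exact ((hasDerivAt_id x).sub_const _).congr_of_eventuallyEq h

lemma hasDerivAt_bernTwo {x : ℝ} (hx : Int.fract x ≠ 0) :
    HasDerivAt bernTwo (2 * saw x) x := by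
  have h := hasDerivAt_fract hx
  convert! ((h.pow 2).sub h).add_const (1 / 6 : ℝ) using 1
  rw [saw, if_neg hx]; push_cast; ring

lemma hasDerivAt_bernThree {x : ℝ} (hx : Int.fract x ≠ 0) :
    HasDerivAt bernThree (3 * bernTwo x) x := by
  have h := hasDerivAt_fract hx
  convert! ((h.pow 3).sub ((h.pow 2).const_mul (3 / 2 : ℝ))).add (h.const_mul (1 / 2 : ℝ)) using 1
  rw [bernTwo]; push_cast; ring

lemma intervalIntegrable_saw_mul_saw (a b u v : ℝ) :
    IntervalIntegrable (fun x => saw (x / a) * saw (x / b)) volume u v := by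
  refine (intervalIntegrable_const (c := (1 : ℝ))).mono_fun ?_ ?_
  · exact ((measurable_saw.comp (measurable_id.div_const a)).mul
      (measurable_saw.comp (measurable_id.div_const b))).aestronglyMeasurable
  · filter_upwards with x
    rw [Real.norm_eq_abs, abs_mul, norm_one]
    nlinarith [abs_saw_le (x / a), abs_saw_le (x / b), abs_nonneg (saw (x / a)),
      abs_nonneg (saw (x / b))]

lemma countable_fract_div_eq_zero {a : ℝ} (ha : 0 < a) :
    {x : ℝ | Int.fract (x / a) = 0}.Countable := by
  refine (Set.countable_range (fun n : ℤ => (n : ℝ) * a)).mono ?_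
  intro x hx
  refine ⟨⌊x / a⌋, ?_⟩
  have h : x / a - ⌊x / a⌋ = 0 := hx
  have h2 : (⌊x / a⌋ : ℝ) = x / a := by linarith
  simp only [h2]
  field_simp

/-- Over one period of `saw (· / b)`, the correlation of two sawtooth functions is computed by
integration by parts. -/
lemma integral_saw_mul_saw_period {a b : ℝ} (ha : 0 < a) (hb : 0 < b) (m : ℕ) :
    ∫ x in (m * b)..((m + 1 : ℕ) * b), saw (x / a) * saw (x / b) =
      a / 4 * (bernTwo (m * b / a) + bernTwo ((m + 1 : ℕ) * b / a)) -
        a ^ 2 / (6 * b) * (bernThree ((m + 1 : ℕ) * b / a) - bernThree (m * b / a)) := by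
  have hle : (m : ℝ) * b ≤ (m + 1 : ℕ) * b := by push_cast; nlinarith
  have key := integral_eq_of_hasDerivAt_off_countable
    (fun x => a / 2 * (bernTwo (x / a) * (x / b - m - 1 / 2)) - a ^ 2 / (6 * b) * bernThree (x / a))
    (fun x => saw (x / a) * saw (x / b)) (a := m * b) (b := (m + 1 : ℕ) * b)
    (countable_fract_div_eq_zero ha) ?_ ?_ (intervalIntegrable_saw_mul_saw _ _ _ _)
  · rw [key]
    push_cast
    field_simp
    ring
  · have h2 : Continuous fun x : ℝ => bernTwo (x / a) :=
      continuous_bernTwo.comp (continuous_id.div_const a)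
    have h3 : Continuous fun x : ℝ => bernThree (x / a) :=
      continuous_bernThree.comp (continuous_id.div_const a)
    exact Continuous.continuousOn (by fun_prop)
  · rintro x ⟨hx, hxa⟩
    rw [min_eq_left hle, max_eq_right hle] at hx
    have h1 : (m : ℝ) < x / b := by rw [lt_div_iff₀ hb]; exact hx.1
    have h2 : x / b < m + 1 := by
      rw [div_lt_iff₀ hb]; have := hx.2; push_cast at this; exact this
    have hfl : ⌊x / b⌋ = (m : ℤ) := Int.floor_eq_iff.2 ⟨by exact_mod_cast h1.le, by exact_mod_cast h2⟩
    have hfr : Int.fract (x / b) = x / b - m := by rw [Int.fract, hfl]; simp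
    have hsb : saw (x / b) = x / b - m - 1 / 2 := by
      rw [saw, hfr, if_neg (by linarith)]
    have hd : HasDerivAt (fun t : ℝ => t / a) (1 / a) x := (hasDerivAt_id x).div_const a
    have hd2 := (hasDerivAt_bernTwo hxa).comp x hd
    have hd3 := (hasDerivAt_bernThree hxa).comp x hd
    have hl : HasDerivAt (fun t : ℝ => t / b - m - 1 / 2) (1 / b) x :=
      (((hasDerivAt_id x).div_const b).sub_const _).sub_const _
    convert! ((hd2.mul hl).const_mul (a / 2)).sub (hd3.const_mul (a ^ 2 / (6 * b))) using 1
    rw [hsb]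
    simp only [Function.comp_apply]
    field_simp
    ring

lemma integral_saw_mul_saw_periods {a b : ℝ} (ha : 0 < a) (hb : 0 < b) (M : ℕ) :
    ∫ x in (0 : ℝ)..(M * b), saw (x / a) * saw (x / b) =
      a / 2 * ∑ m ∈ Finset.range M, bernTwo (m * b / a) +
        a / 4 * (bernTwo (M * b / a) - bernTwo 0) -
        a ^ 2 / (6 * b) * (bernThree (M * b / a) - bernThree 0) := by
  induction M with
  | zero => simp
  | succ M ih =>
    rw [← intervalIntegral.integral_add_adjacent_intervals
      (intervalIntegrable_saw_mul_saw a b 0 (M * b))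
      (intervalIntegrable_saw_mul_saw a b _ _), ih, integral_saw_mul_saw_period ha hb,
      Finset.sum_range_succ]
    ring

lemma abs_integral_saw_mul_saw_le {a b y : ℝ} (ha : 0 < a) (hb : 0 < b) (hab : a ≤ 2 * b)
    (hy : 0 ≤ y) :
    |∫ x in (0 : ℝ)..y, saw (x / a) * saw (x / b)| ≤
      a / 2 * |∑ m ∈ Finset.range ⌊y / b⌋₊, bernTwo (m * b / a)| + a + b := by
  set M := ⌊y / b⌋₊
  have hM : (M : ℝ) * b ≤ y := (le_div_iff₀ hb).1 (Nat.floor_le (by positivity))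
  have hM' : y < (M + 1) * b := (div_lt_iff₀ hb).1 (Nat.lt_floor_add_one _)
  rw [← intervalIntegral.integral_add_adjacent_intervals
      (intervalIntegrable_saw_mul_saw a b 0 (M * b))
      (intervalIntegrable_saw_mul_saw a b _ _), integral_saw_mul_saw_periods ha hb]
  have hrest : |∫ x in (M * b)..y, saw (x / a) * saw (x / b)| ≤ 1 * |y - M * b| := by
    rw [← Real.norm_eq_abs]
    refine intervalIntegral.norm_integral_le_of_norm_le_const fun x _ => ?_
    rw [Real.norm_eq_abs, abs_mul]
    nlinarith [abs_saw_le (x / a), abs_saw_le (x / b), abs_nonneg (saw (x / a)),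
      abs_nonneg (saw (x / b))]
  rw [abs_of_nonneg (by linarith : 0 ≤ y - M * b)] at hrest
  set I := ∫ x in (M * b)..y, saw (x / a) * saw (x / b)
  set S := ∑ m ∈ Finset.range M, bernTwo (m * b / a)
  have h2 : |a / 4 * (bernTwo (M * b / a) - bernTwo 0)| ≤ a / 12 := by
    rw [abs_mul, abs_of_pos (by positivity : 0 < a / 4)]
    have := abs_sub (bernTwo (M * b / a)) (bernTwo 0)
    have := abs_bernTwo_le (M * b / a)
    have := abs_bernTwo_le 0
    nlinarith
  have h3 : |a ^ 2 / (6 * b) * (bernThree (M * b / a) - bernThree 0)| ≤ a / 12 := by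
    have hc : a ^ 2 / (6 * b) ≤ a / 3 := by
      rw [div_le_div_iff₀ (by positivity) (by norm_num)]; nlinarith
    rw [abs_mul, abs_of_pos (by positivity : 0 < a ^ 2 / (6 * b))]
    have h := abs_sub (bernThree (M * b / a)) (bernThree 0)
    have := abs_bernThree_le (M * b / a)
    have := abs_bernThree_le 0
    calc _ ≤ a / 3 * (1 / 4) := mul_le_mul hc (by linarith) (abs_nonneg _) (by positivity)
      _ = a / 12 := by ring
  have h1 : |a / 2 * S| = a / 2 * |S| := by rw [abs_mul, abs_of_pos (by positivity : 0 < a / 2)]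
  have t1 := abs_add_le (a / 2 * S + a / 4 * (bernTwo (M * b / a) - bernTwo 0) -
        a ^ 2 / (6 * b) * (bernThree (M * b / a) - bernThree 0)) I
  have t2 := abs_sub (a / 2 * S + a / 4 * (bernTwo (M * b / a) - bernTwo 0))
        (a ^ 2 / (6 * b) * (bernThree (M * b / a) - bernThree 0))
  have t3 := abs_add_le (a / 2 * S) (a / 4 * (bernTwo (M * b / a) - bernTwo 0))
  linarith

lemma harmonic_nonneg_real (a : ℕ) : (0 : ℝ) ≤ harmonic a := by
  have : (0 : ℚ) ≤ harmonic a := Finset.sum_nonneg fun i _ => by positivity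
  exact_mod_cast this

lemma hasSum_bernTwo (x : ℝ) :
    HasSum (fun k : ℕ => 1 / (k : ℝ) ^ 2 * Real.cos (2 * π * k * x)) (π ^ 2 * bernTwo x) := by
  have h := hasSum_one_div_nat_pow_mul_cos one_ne_zero
    (x := Int.fract x) ⟨Int.fract_nonneg x, (Int.fract_lt_one x).le⟩
  convert! h using 1
  · funext k
    have : 2 * π * k * x = 2 * π * k * Int.fract x + ((k * ⌊x⌋ : ℤ) : ℝ) * (2 * π) := by
      rw [Int.fract]; push_cast; ring
    rw [this, Real.cos_add_int_mul_two_pi, mul_one]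
  · rw [bernTwo]
    simp [Polynomial.bernoulli, Finset.sum_range_succ, bernoulli_one, bernoulli_two]
    norm_num
    ring

lemma abs_sum_cos_mul_sin_le (M : ℕ) (t : ℝ) :
    |∑ m ∈ Finset.range M, Real.cos (2 * t * m)| * |Real.sin t| ≤ 1 := by
  have h : (∑ m ∈ Finset.range M, Real.cos (2 * t * m)) * Real.sin t =
      (Real.sin (2 * t * M - t) + Real.sin t) / 2 := by
    induction M with
    | zero => simp
    | succ M ih =>
      rw [Finset.sum_range_succ, add_mul, ih]
      have e : 2 * t * (M + 1 : ℕ) - t = 2 * t * M + t := by push_cast; ring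
      rw [e, Real.sin_add, Real.sin_sub]
      ring
  rw [← abs_mul, h, abs_le]
  have := Real.sin_le_one t
  have := Real.neg_one_le_sin t
  have := Real.sin_le_one (2 * t * M - t)
  have := Real.neg_one_le_sin (2 * t * M - t)
  constructor <;> linarith

lemma one_le_mul_sin_pi {θ : ℝ} (h0 : 0 < θ) (h1 : θ < 1) :
    1 ≤ (1 / θ + 1 / (1 - θ)) / 2 * Real.sin (π * θ) := by
  have hpi := Real.pi_pos
  have h1' : 0 < 1 - θ := by linarith
  have hs : 2 * (θ * (1 - θ)) ≤ Real.sin (π * θ) := by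
    rcases le_total θ (1 / 2) with h | h
    · have := Real.mul_le_sin (x := π * θ) (by positivity) (by nlinarith)
      have e : 2 / π * (π * θ) = 2 * θ := by field_simp
      nlinarith
    · have := Real.mul_le_sin (x := π * (1 - θ)) (by positivity) (by nlinarith)
      have e : 2 / π * (π * (1 - θ)) = 2 * (1 - θ) := by field_simp
      have e' : π * (1 - θ) = π - π * θ := by ring
      rw [e, e', Real.sin_pi_sub] at this
      nlinarith
  have e : (1 / θ + 1 / (1 - θ)) / 2 = 1 / (2 * (θ * (1 - θ))) := by field_simp; ring
  rw [e, div_mul_eq_mul_div, one_mul, le_div_iff₀ (by positivity)]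
  linarith

/-- A majorant for `∑ cos (2 π m r / a)` over initial segments of length at most `Y`. -/
noncomputable def cosMajorant (a : ℕ) (Y : ℝ) (r : ℕ) : ℝ :=
  (if r = 0 then Y else 0) + (a : ℝ) / 2 * (1 / (r : ℝ) + 1 / ((a : ℝ) - r))

lemma cosMajorant_nonneg {a r : ℕ} {Y : ℝ} (hY : 0 ≤ Y) (hr : r < a) : 0 ≤ cosMajorant a Y r := by
  have : (0 : ℝ) < (a : ℝ) - r := sub_pos.2 (by exact_mod_cast hr)
  unfold cosMajorant
  split_ifs <;> positivity

lemma abs_sum_cos_le_cosMajorant {a M : ℕ} (ha : 0 < a) {Y : ℝ} (hM : (M : ℝ) ≤ Y) (c : ℕ) :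
    |∑ m ∈ Finset.range M, Real.cos (2 * π * (c / a) * m)| ≤ cosMajorant a Y (c % a) := by
  have ha' : (0 : ℝ) < a := by exact_mod_cast ha
  have hra : c % a < a := Nat.mod_lt _ ha
  have hra' : ((c % a : ℕ) : ℝ) < a := by exact_mod_cast hra
  by_cases hr : c % a = 0
  · have h1 : |∑ m ∈ Finset.range M, Real.cos (2 * π * (c / a) * m)| ≤ M := by
      refine (Finset.abs_sum_le_sum_abs _ _).trans ?_
      refine (Finset.sum_le_sum fun m _ => Real.abs_cos_le_one _).trans ?_
      simp
    rw [cosMajorant, hr]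
    simp only [if_true, Nat.cast_zero, sub_zero, div_zero, zero_add]
    have : (0 : ℝ) ≤ a / 2 * (1 / a) := by positivity
    linarith
  · have hr0 : (0 : ℝ) < (c % a : ℕ) := by exact_mod_cast Nat.pos_of_ne_zero hr
    set r := c % a with hrdef
    have hca : (c : ℝ) = a * (c / a : ℕ) + r := by exact_mod_cast (Nat.div_add_mod c a).symm
    have hcos : ∀ m : ℕ, Real.cos (2 * π * (c / a) * m) = Real.cos (2 * (π * (r / a)) * m) := by
      intro m
      have : 2 * π * (c / a) * m = 2 * (π * (r / a)) * m + ((c / a * m : ℕ) : ℝ) * (2 * π) := by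
        rw [hca]; push_cast; field_simp; ring
      rw [this, Real.cos_add_nat_mul_two_pi]
    simp_rw [hcos]
    have h0 : (0 : ℝ) < r / a := by positivity
    have h1 : (r : ℝ) / a < 1 := (div_lt_one ha').2 hra'
    have hs := one_le_mul_sin_pi h0 h1
    have hb := abs_sum_cos_mul_sin_le M (π * (r / a))
    have har : (0 : ℝ) < a - r := by linarith
    have hmaj : cosMajorant a Y r = (1 / ((r : ℝ) / a) + 1 / (1 - (r : ℝ) / a)) / 2 := by
      have : 1 - (r : ℝ) / a = (a - r) / a := by field_simp
      rw [cosMajorant, if_neg hr, this]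
      field_simp
      ring
    rw [hmaj]
    have hp : 0 < (1 / ((r : ℝ) / a) + 1 / (1 - (r : ℝ) / a)) / 2 := by
      have : 0 < 1 - (r : ℝ) / a := by linarith
      positivity
    have hsin : 0 < Real.sin (π * (r / a)) := by
      by_contra hneg
      nlinarith
    rw [abs_of_pos hsin] at hb
    exact le_of_mul_le_mul_right (hb.trans hs) hsin

lemma sum_cosMajorant_le (a : ℕ) {Y : ℝ} (hY : 0 ≤ Y) :
    ∑ r ∈ Finset.range a, cosMajorant a Y r ≤ Y + a * (harmonic a : ℝ) := by
  have hH : (harmonic a : ℝ) = ∑ r ∈ Finset.range a, 1 / ((r : ℝ) + 1) := by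
    simp [harmonic]
  have h1 : ∑ r ∈ Finset.range a, (if r = 0 then Y else 0) ≤ Y := by
    rw [Finset.sum_ite_eq']; split_ifs <;> linarith
  have h2 : ∑ r ∈ Finset.range a, 1 / (r : ℝ) ≤ harmonic a := by
    rw [hH]
    cases a with
    | zero => simp
    | succ n =>
      rw [Finset.sum_range_succ', Finset.sum_range_succ _ n]
      push_cast
      have : (0 : ℝ) ≤ 1 / ((n : ℝ) + 1) := by positivity
      simp only [div_zero, add_zero]
      linarith
  have h3 : ∑ r ∈ Finset.range a, 1 / ((a : ℝ) - r) = harmonic a := by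
    rw [hH, ← Finset.sum_range_reflect]
    refine Finset.sum_congr rfl fun r hr => ?_
    have hr' : r + 1 ≤ a := Finset.mem_range.1 hr
    rw [Nat.sub_sub, Nat.cast_sub (by omega)]
    push_cast
    congr 1
    ring
  unfold cosMajorant
  rw [Finset.sum_add_distrib, ← Finset.mul_sum, Finset.sum_add_distrib, h3]
  have : (0 : ℝ) ≤ a := Nat.cast_nonneg a
  nlinarith

/-- A congruence `k * b ≡ r (mod a)` has at most `gcd a k` solutions among `a` consecutive
integers. -/
lemma card_filter_mul_mod_le {a : ℕ} (ha : 0 < a) (k n n' r : ℕ) (hn : n' ≤ n + a) :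
    ((Finset.Ioc n n').filter fun b => k * b % a = r).card ≤ a.gcd k := by
  have hg : 0 < a.gcd k := Nat.gcd_pos_of_pos_left _ ha
  set d := a / a.gcd k with hd
  have had : d * a.gcd k = a := Nat.div_mul_cancel (Nat.gcd_dvd_left a k)
  have hd0 : 0 < d := Nat.pos_of_ne_zero fun h => by rw [h] at had; omega
  rw [← Finset.card_range (a.gcd k)]
  refine Finset.card_le_card_of_injOn (fun b => (b - n - 1) / d) ?_ ?_
  · intro b hb
    have hb := Finset.mem_Ioc.1 (Finset.mem_filter.1 (Finset.mem_coe.1 hb)).1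
    refine Finset.mem_coe.2 (Finset.mem_range.2 ?_)
    rw [Nat.div_lt_iff_lt_mul hd0, mul_comm, had]
    omega
  · intro b hb c hc hbc
    obtain ⟨hb, hbr⟩ := Finset.mem_filter.1 (Finset.mem_coe.1 hb)
    obtain ⟨hc, hcr⟩ := Finset.mem_filter.1 (Finset.mem_coe.1 hc)
    rw [Finset.mem_Ioc] at hb hc
    have hmod : b ≡ c [MOD d] :=
      Nat.ModEq.cancel_left_div_gcd ha (show k * b % a = k * c % a by rw [hbr, hcr])
    have hmod' : b - n - 1 ≡ c - n - 1 [MOD d] := by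
      refine Nat.ModEq.add_right_cancel' (n + 1) ?_
      rwa [show b - n - 1 + (n + 1) = b by omega, show c - n - 1 + (n + 1) = c by omega]
    have e1 := Nat.div_add_mod (b - n - 1) d
    have e2 := Nat.div_add_mod (c - n - 1) d
    simp only at hbc
    rw [hbc, hmod'] at e1
    omega

lemma sum_abs_sum_cos_le {a : ℕ} (ha : 0 < a) (k n n' : ℕ) (hn : n' ≤ n + a) {Y : ℝ}
    (hY : 0 ≤ Y) (M : ℕ → ℕ) (hM : ∀ b ∈ Finset.Ioc n n', (M b : ℝ) ≤ Y) :
    ∑ b ∈ Finset.Ioc n n', |∑ m ∈ Finset.range (M b), Real.cos (2 * π * k * (m * b / a))| ≤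
      a.gcd k * (Y + a * (harmonic a : ℝ)) := by
  calc _ ≤ ∑ b ∈ Finset.Ioc n n', cosMajorant a Y (k * b % a) := by
        refine Finset.sum_le_sum fun b hb => ?_
        refine le_trans (le_of_eq ?_) (abs_sum_cos_le_cosMajorant ha (hM b hb) (k * b))
        congr 1
        refine Finset.sum_congr rfl fun m _ => ?_
        congr 1
        push_cast
        ring
    _ = ∑ r ∈ Finset.range a, ∑ b ∈ Finset.Ioc n n' with k * b % a = r,
          cosMajorant a Y (k * b % a) :=
        (Finset.sum_fiberwise_of_maps_to
          (fun b _ => Finset.mem_range.2 (Nat.mod_lt _ ha)) _).symm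
    _ ≤ ∑ r ∈ Finset.range a, a.gcd k * cosMajorant a Y r := by
        refine Finset.sum_le_sum fun r hr => ?_
        have hcm := cosMajorant_nonneg hY (Finset.mem_range.1 hr)
        rw [Finset.sum_congr rfl (g := fun _ => cosMajorant a Y r)
          (fun b hb => by rw [(Finset.mem_filter.1 hb).2]), Finset.sum_const, nsmul_eq_mul]
        gcongr
        exact card_filter_mul_mod_le ha k n n' r hn
    _ ≤ _ := by
        rw [← Finset.mul_sum]
        gcongr
        exact sum_cosMajorant_le a hY

lemma hasSum_dvd_indicator {g : ℕ} (hg : 0 < g) :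
    HasSum (fun k : ℕ => if g ∣ k then (g : ℝ) / (k : ℝ) ^ 2 else 0) (1 / g * (π ^ 2 / 6)) := by
  have hinj : Function.Injective fun j : ℕ => g * j := fun _ _ h => Nat.eq_of_mul_eq_mul_left hg h
  rw [← hinj.hasSum_iff]
  · convert! hasSum_zeta_two.mul_left (1 / (g : ℝ)) using 1
    funext j
    have : (g : ℝ) ≠ 0 := by positivity
    simp only [Function.comp_apply, dvd_mul_right, if_true]
    push_cast
    rcases eq_or_ne (j : ℝ) 0 with h | h
    · simp [h]
    · field_simp
  · intro k hk
    refine if_neg fun ⟨j, hj⟩ => hk ⟨j, hj.symm⟩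

lemma gcd_div_sq_le {a : ℕ} (ha : 0 < a) (k : ℕ) :
    (a.gcd k : ℝ) / (k : ℝ) ^ 2 ≤
      ∑ g ∈ Finset.range a, if g + 1 ∣ k then ((g + 1 : ℕ) : ℝ) / (k : ℝ) ^ 2 else 0 := by
  have hg : 0 < a.gcd k := Nat.gcd_pos_of_pos_left _ ha
  have hle : a.gcd k ≤ a := Nat.gcd_le_left k ha
  have e : a.gcd k - 1 + 1 = a.gcd k := by omega
  refine le_trans (le_of_eq ?_) (Finset.single_le_sum (fun g _ => ?_)
    (Finset.mem_range.2 (by omega : a.gcd k - 1 < a)))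
  · rw [e, if_pos (Nat.gcd_dvd_right a k)]
  · split_ifs <;> positivity

lemma sum_abs_sum_bernTwo_le {a : ℕ} (ha : 0 < a) (n n' : ℕ) (hn : n' ≤ n + a) {Y : ℝ}
    (hY : 0 ≤ Y) (M : ℕ → ℕ) (hM : ∀ b ∈ Finset.Ioc n n', (M b : ℝ) ≤ Y) :
    ∑ b ∈ Finset.Ioc n n', |∑ m ∈ Finset.range (M b), bernTwo (m * b / a)| ≤
      (Y + a * (harmonic a : ℝ)) * harmonic a / 6 := by
  set W := Y + a * (harmonic a : ℝ) with hWdef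
  have hHnn := harmonic_nonneg_real a
  have hW : 0 ≤ W := by positivity
  have hmaj : HasSum (fun k : ℕ => W * ∑ g ∈ Finset.range a,
      if g + 1 ∣ k then ((g + 1 : ℕ) : ℝ) / (k : ℝ) ^ 2 else 0)
      (W * (harmonic a * (π ^ 2 / 6))) := by
    have e : (harmonic a : ℝ) * (π ^ 2 / 6) =
        ∑ g ∈ Finset.range a, 1 / ((g + 1 : ℕ) : ℝ) * (π ^ 2 / 6) := by
      rw [← Finset.sum_mul]; simp [harmonic]
    rw [e]
    exact (hasSum_sum fun g _ => hasSum_dvd_indicator g.succ_pos).mul_left W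
  have hsgn : ∀ b : ℕ, ∃ s : ℝ, |s| ≤ 1 ∧
      |∑ m ∈ Finset.range (M b), bernTwo (m * b / a)| =
        s * ∑ m ∈ Finset.range (M b), bernTwo (m * b / a) := by
    intro b
    rcases abs_choice (∑ m ∈ Finset.range (M b), bernTwo (m * b / a)) with h | h
    · exact ⟨1, by simp, by rw [h, one_mul]⟩
    · exact ⟨-1, by simp, by rw [h, neg_one_mul]⟩
  choose s hs hs' using hsgn
  have hsum : HasSum (fun k : ℕ => ∑ b ∈ Finset.Ioc n n', s b * ∑ m ∈ Finset.range (M b),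
      1 / (k : ℝ) ^ 2 * Real.cos (2 * π * k * (m * b / a)))
      (∑ b ∈ Finset.Ioc n n', s b * ∑ m ∈ Finset.range (M b), π ^ 2 * bernTwo (m * b / a)) :=
    hasSum_sum fun b _ => (hasSum_sum fun m _ => hasSum_bernTwo _).mul_left _
  have hle := hasSum_le (fun k => ?_) hsum hmaj
  · have e : ∑ b ∈ Finset.Ioc n n', s b * ∑ m ∈ Finset.range (M b), π ^ 2 * bernTwo (m * b / a) =
        π ^ 2 * ∑ b ∈ Finset.Ioc n n', |∑ m ∈ Finset.range (M b), bernTwo (m * b / a)| := by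
      rw [Finset.mul_sum]
      refine Finset.sum_congr rfl fun b _ => ?_
      rw [hs', ← Finset.mul_sum]
      ring
    rw [e] at hle
    have hpi : 0 < π ^ 2 := by positivity
    refine le_of_mul_le_mul_left (hle.trans (le_of_eq ?_)) hpi
    ring
  · calc _ ≤ ∑ b ∈ Finset.Ioc n n', 1 / (k : ℝ) ^ 2 *
            |∑ m ∈ Finset.range (M b), Real.cos (2 * π * k * (m * b / a))| := by
          refine Finset.sum_le_sum fun b _ => ?_
          rw [← Finset.mul_sum]
          refine (le_abs_self _).trans ?_
          rw [abs_mul, abs_mul, abs_of_nonneg (by positivity : 0 ≤ 1 / (k : ℝ) ^ 2)]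
          exact mul_le_of_le_one_left (by positivity) (hs b)
      _ ≤ 1 / (k : ℝ) ^ 2 * (a.gcd k * W) := by
          rw [← Finset.mul_sum]
          gcongr
          exact sum_abs_sum_cos_le ha k n n' hn hY M hM
      _ = W * (a.gcd k / (k : ℝ) ^ 2) := by ring
      _ ≤ _ := by
          gcongr
          exact gcd_div_sq_le ha k

lemma sum_abs_integral_saw_mul_saw_le {y N : ℝ} (hN : 1 ≤ N) (hNy : N ≤ y) {a : ℕ}
    (ha : a ∈ Finset.Ioc ⌊N⌋₊ ⌊2 * N⌋₊) :
    ∑ b ∈ Finset.Ioc ⌊N⌋₊ ⌊2 * N⌋₊, |∫ x in (0 : ℝ)..y, saw (x / a) * saw (x / b)| ≤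
      8 * N ^ 2 + N / 6 * ((y / N + 2 * N * harmonic a) * harmonic a) := by
  have hN0 : 0 < N := by linarith
  have hy0 : 0 < y := by linarith
  have hmem : ∀ b ∈ Finset.Ioc ⌊N⌋₊ ⌊2 * N⌋₊, N < b ∧ (b : ℝ) ≤ 2 * N := fun b hb =>
    ⟨Nat.lt_of_floor_lt (Finset.mem_Ioc.1 hb).1,
      (Nat.le_floor_iff (by positivity)).1 (Finset.mem_Ioc.1 hb).2⟩
  obtain ⟨haN, ha2⟩ := hmem a ha
  have ha0 : (0 : ℝ) < a := by linarith
  have hfl : ⌊2 * N⌋₊ ≤ 2 * ⌊N⌋₊ + 1 := by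
    have h1 := Nat.lt_floor_add_one N
    have : ⌊2 * N⌋₊ < 2 * ⌊N⌋₊ + 2 :=
      (Nat.floor_lt (by positivity)).2 (by push_cast; linarith)
    omega
  have hlen : ⌊2 * N⌋₊ ≤ ⌊N⌋₊ + a := by have := (Finset.mem_Ioc.1 ha).1; omega
  have hcard : ((Finset.Ioc ⌊N⌋₊ ⌊2 * N⌋₊).card : ℝ) ≤ 2 * N := by
    rw [Nat.card_Ioc]
    exact (Nat.cast_le.2 (Nat.sub_le _ _)).trans (Nat.floor_le (by positivity))
  have hB := sum_abs_sum_bernTwo_le (by exact_mod_cast ha0) ⌊N⌋₊ ⌊2 * N⌋₊ hlen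
    (Y := y / N) (by positivity) (fun b => ⌊y / b⌋₊) (fun b hb => by
      have hb := (hmem b hb).1
      have hb0 : (0 : ℝ) < b := by linarith
      exact (Nat.floor_le (by positivity)).trans (by gcongr))
  have hH := harmonic_nonneg_real a
  calc _ ≤ ∑ b ∈ Finset.Ioc ⌊N⌋₊ ⌊2 * N⌋₊,
          (N * |∑ m ∈ Finset.range ⌊y / b⌋₊, bernTwo (m * b / a)| + 4 * N) := by
        refine Finset.sum_le_sum fun b hb => ?_
        obtain ⟨hbN, hb2⟩ := hmem b hb
        have h := abs_integral_saw_mul_saw_le (y := y) ha0 (by linarith : (0 : ℝ) < b)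
          (by linarith) (by linarith)
        refine h.trans ?_
        have : (a : ℝ) / 2 ≤ N := by linarith
        have := mul_le_mul_of_nonneg_right this
          (abs_nonneg (∑ m ∈ Finset.range ⌊y / b⌋₊, bernTwo (m * b / a)))
        linarith
    _ ≤ N * ((y / N + a * harmonic a) * harmonic a / 6) + 2 * N * (4 * N) := by
        rw [Finset.sum_add_distrib, ← Finset.mul_sum, Finset.sum_const, nsmul_eq_mul]
        gcongr
    _ ≤ N * ((y / N + 2 * N * harmonic a) * harmonic a / 6) + 2 * N * (4 * N) := by
        gcongr
    _ = _ := by ring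

lemma cube_div_le {y N : ℝ} (hN : 0 < N) (hNy : N ≤ y) :
    N ^ 3 / y ≤ N ^ 2 * Real.sqrt N / Real.sqrt y := by
  have hy : 0 < y := by linarith
  have hsy : 0 < Real.sqrt y := Real.sqrt_pos.2 hy
  have hs : Real.sqrt N ≤ Real.sqrt y := Real.sqrt_le_sqrt hNy
  have e1 := Real.mul_self_sqrt hN.le
  have e2 := Real.mul_self_sqrt hy.le
  rw [div_le_div_iff₀ hy hsy]
  calc N ^ 3 * √y = N ^ 2 * √N * (√N * √y) := by
        linear_combination -(N ^ 2 * √y) * e1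
    _ ≤ N ^ 2 * √N * (√y * √y) := by gcongr
    _ = _ := by rw [e2]

/-- Lemma 7.2: mean square bound for correlations of sawtooth functions. -/
theorem sawtooth_correlation_mean_bound :
    ∃ A : ℝ, ∀ y : ℝ, 2 ≤ y → ∀ N : ℝ, 1 ≤ N → N ≤ y →
      ∑ n₁ ∈ Finset.Ioc ⌊N⌋₊ ⌊2 * N⌋₊, ∑ n₂ ∈ Finset.Ioc ⌊N⌋₊ ⌊2 * N⌋₊,
          |(1 / y) * ∫ x in (0 : ℝ)..y, saw (x / n₁) * saw (x / n₂)| ≤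
        A * Real.log y ^ 2 * (N + N ^ 2 * Real.sqrt N / Real.sqrt y) := by
  refine ⟨100, fun y hy N hN hNy => ?_⟩
  have hN0 : 0 < N := by linarith
  have hy0 : 0 < y := by linarith
  set L := Real.log y with hLdef
  have hlog2 : 0.6931471803 < Real.log 2 := Real.log_two_gt_d9
  have hL2 : Real.log 2 ≤ L := Real.log_le_log (by norm_num) hy
  have hL : 0.69 ≤ L := by linarith
  have hrow : ∀ a ∈ Finset.Ioc ⌊N⌋₊ ⌊2 * N⌋₊, ∑ b ∈ Finset.Ioc ⌊N⌋₊ ⌊2 * N⌋₊,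
      |(1 / y) * ∫ x in (0 : ℝ)..y, saw (x / a) * saw (x / b)| ≤
        8 * (N ^ 2 / y) + 2 / 3 * L + 16 / 3 * (N ^ 2 / y) * L ^ 2 := by
    intro a ha
    have ha1 : (1 : ℝ) ≤ a := by
      exact_mod_cast Nat.one_le_iff_ne_zero.2 (by have := (Finset.mem_Ioc.1 ha).1; omega)
    have ha2 : (a : ℝ) ≤ 2 * N :=
      (Nat.le_floor_iff (by positivity)).1 (Finset.mem_Ioc.1 ha).2
    have hH0 := harmonic_nonneg_real a
    have hH : (harmonic a : ℝ) ≤ 4 * L := by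
      have h1 := harmonic_le_one_add_log a
      have h2 : Real.log a ≤ Real.log (2 * y) := Real.log_le_log (by linarith) (by linarith)
      rw [Real.log_mul (by norm_num) hy0.ne'] at h2
      linarith
    simp_rw [abs_mul, ← Finset.mul_sum]
    rw [abs_of_pos (by positivity : 0 < 1 / y)]
    calc _ ≤ 1 / y * (8 * N ^ 2 + N / 6 * ((y / N + 2 * N * (4 * L)) * (4 * L))) := by
          gcongr
          refine (sum_abs_integral_saw_mul_saw_le hN hNy ha).trans ?_
          gcongr
      _ = _ := by field_simp; ring
  have hcard : ((Finset.Ioc ⌊N⌋₊ ⌊2 * N⌋₊).card : ℝ) ≤ 2 * N := by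
    rw [Nat.card_Ioc]
    exact (Nat.cast_le.2 (Nat.sub_le _ _)).trans (Nat.floor_le (by positivity))
  have hcube := cube_div_le hN0 hNy
  set Q := N ^ 2 * Real.sqrt N / Real.sqrt y
  have hP : 0 ≤ N ^ 3 / y := by positivity
  have hLL : 0.69 * L ≤ L ^ 2 := by nlinarith
  have hL1 : 0.47 ≤ L ^ 2 := by nlinarith
  calc _ ≤ ∑ a ∈ Finset.Ioc ⌊N⌋₊ ⌊2 * N⌋₊,
        (8 * (N ^ 2 / y) + 2 / 3 * L + 16 / 3 * (N ^ 2 / y) * L ^ 2) := Finset.sum_le_sum hrow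
    _ ≤ 2 * N * (8 * (N ^ 2 / y) + 2 / 3 * L + 16 / 3 * (N ^ 2 / y) * L ^ 2) := by
        rw [Finset.sum_const, nsmul_eq_mul]
        gcongr
    _ = 16 * (N ^ 3 / y) + 4 / 3 * (N * L) + 32 / 3 * (N ^ 3 / y * L ^ 2) := by ring
    _ ≤ 100 * L ^ 2 * (N + N ^ 3 / y) := by
        have h1 : N ^ 3 / y * 0.47 ≤ N ^ 3 / y * L ^ 2 := mul_le_mul_of_nonneg_left hL1 hP
        have h2 : N * (0.69 * L) ≤ N * L ^ 2 := mul_le_mul_of_nonneg_left hLL hN0.le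
        have h3 : 0 ≤ N * L ^ 2 := by positivity
        have h4 : 0 ≤ N ^ 3 / y * L ^ 2 := by positivity
        nlinarith
    _ ≤ _ := by gcongr
end
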